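/- Let a, b_1,…,b_s ∈ ℓ¹(ℤ^d) and let M, M_1,…,M_s be d×d invertible integer matrices. The perfect reconstruction identity v = |det M|^{-1} S_{a,M}T_{a,M} v + Σ_{ℓ=1}^s |det M_ℓ|^{-1} S_{b_ℓ,M_ℓ}T_{b_ℓ,M_ℓ} v for all v ∈ ℓ^∞(ℤ^d) holds if and only if |â(ξ)|² + Σ_ℓ |b̂_ℓ(ξ)|² = 1 a.e. and, for every ω ∈ (Ω_M ∪ ⋃_ℓ Ω_{M_ℓ}) \ {0}, the identity χ_{M^{-T}ℤ^d}(ω) â(ξ) conj(â(ξ+2πω)) + Σ_ℓ χ_{M_ℓ^{-T}ℤ^d}(ω) b̂_ℓ(ξ) conj(b̂_ℓ(ξ+2πω)) = 0 holds for a.e. ξ, where Ω_N := (N^{-T}ℤ^d) ∩ [0,1)^d. -/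

import Mathlib

open scoped BigOperators
open MeasureTheory Classical

/-- The subdivision operator on ℤ^d with sampling matrix `N`. -/
noncomputable def subdivOp {d : ℕ} (u : (Fin d → ℤ) → ℂ) (N : Matrix (Fin d) (Fin d) ℤ)
    (v : (Fin d → ℤ) → ℂ) (n : Fin d → ℤ) : ℂ :=
  ((|N.det| : ℤ) : ℂ) * ∑' k : Fin d → ℤ, v k * u (n - N.mulVec k)

/-- The transition operator on ℤ^d with sampling matrix `N`. -/
noncomputable def transOp {d : ℕ} (u : (Fin d → ℤ) → ℂ) (N : Matrix (Fin d) (Fin d) ℤ)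
    (v : (Fin d → ℤ) → ℂ) (n : Fin d → ℤ) : ℂ :=
  ((|N.det| : ℤ) : ℂ) * ∑' k : Fin d → ℤ, v k * starRingEnd ℂ (u (k - N.mulVec n))

/-- Fourier series `û(ξ) = Σ_{k∈ℤ^d} u(k) e^{-ik·ξ}`. -/
noncomputable def fserd {d : ℕ} (u : (Fin d → ℤ) → ℂ) (ξ : Fin d → ℝ) : ℂ :=
  ∑' k : Fin d → ℤ, u k * Complex.exp (-(Complex.I * ((∑ i, (k i : ℝ) * ξ i : ℝ) : ℂ)))

/-- `ω ∈ N^{-T} ℤ^d`, i.e. `Nᵀ ω ∈ ℤ^d`. -/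
def inLat {d : ℕ} (N : Matrix (Fin d) (Fin d) ℤ) (ω : Fin d → ℝ) : Prop :=
  ∃ k : Fin d → ℤ, (N.map (Int.cast : ℤ → ℝ)).transpose.mulVec ω = fun i => (k i : ℝ)

/-- `Ω_N = (N^{-T} ℤ^d) ∩ [0,1)^d`. -/
def Omega {d : ℕ} (N : Matrix (Fin d) (Fin d) ℤ) : Set (Fin d → ℝ) :=
  {ω | inLat N ω ∧ ∀ i, ω i ∈ Set.Ico (0 : ℝ) 1}

noncomputable def ch {d : ℕ} (ξ : Fin d → ℝ) (k : Fin d → ℤ) : ℂ :=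
  Complex.exp (-(Complex.I * ((∑ i, (k i : ℝ) * ξ i : ℝ) : ℂ)))

lemma ch_add_left {d : ℕ} (ξ η : Fin d → ℝ) (k : Fin d → ℤ) :
    ch (ξ + η) k = ch ξ k * ch η k := by
  unfold ch
  rw [← Complex.exp_add]
  congr 1
  simp only [Pi.add_apply, mul_add, Finset.sum_add_distrib]
  push_cast
  ring

lemma ch_add {d : ℕ} (ξ : Fin d → ℝ) (k l : Fin d → ℤ) :
    ch ξ (k + l) = ch ξ k * ch ξ l := by
  unfold ch
  rw [← Complex.exp_add]
  congr 1
  simp only [Pi.add_apply, Int.cast_add, add_mul, Finset.sum_add_distrib]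
  push_cast
  ring

lemma ch_zero {d : ℕ} (ξ : Fin d → ℝ) : ch ξ 0 = 1 := by simp [ch]

lemma ch_zero_left {d : ℕ} (k : Fin d → ℤ) : ch 0 k = 1 := by simp [ch]

lemma ch_norm {d : ℕ} (ξ : Fin d → ℝ) (k : Fin d → ℤ) : ‖ch ξ k‖ = 1 := by
  unfold ch
  rw [← mul_neg, ← Complex.ofReal_neg, mul_comm, Complex.norm_exp_ofReal_mul_I]

lemma ch_neg {d : ℕ} (ξ : Fin d → ℝ) (k : Fin d → ℤ) :
    ch ξ (-k) = starRingEnd ℂ (ch ξ k) := by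
  unfold ch
  rw [← Complex.exp_conj]
  congr 1
  simp

lemma ch_eq_one_iff {d : ℕ} (ω : Fin d → ℝ) (k : Fin d → ℤ) :
    ch ((2 * Real.pi) • ω) k = 1 ↔ ∃ n : ℤ, ∑ i, (k i : ℝ) * ω i = n := by
  have h : ch ((2 * Real.pi) • ω) k
      = Complex.exp (-(((∑ i, (k i : ℝ) * ω i : ℝ) : ℂ) * (2 * Real.pi * Complex.I))) := by
    unfold ch
    congr 2
    have : (∑ i, (k i : ℝ) * ((2 * Real.pi) • ω) i) = 2 * Real.pi * ∑ i, (k i : ℝ) * ω i := by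
      rw [Finset.mul_sum]
      refine Finset.sum_congr rfl fun i _ => ?_
      simp only [Pi.smul_apply, smul_eq_mul]; ring
    rw [this]
    push_cast
    ring
  rw [h, Complex.exp_neg, inv_eq_one, Complex.exp_eq_one_iff]
  refine exists_congr fun n => ?_
  have := Complex.two_pi_I_ne_zero
  rw [mul_left_inj' this]
  norm_cast

lemma ch_single {d : ℕ} (ω : Fin d → ℝ) (i : Fin d) :
    ch ω (Pi.single i 1) = Complex.exp (-(Complex.I * (ω i : ℂ))) := by
  unfold ch
  congr 3
  norm_cast
  rw [Finset.sum_eq_single i]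
  · simp
  · intro j _ hj; simp [Pi.single_eq_of_ne hj]
  · simp

lemma ch_inj {d : ℕ} (ω ω' : Fin d → ℝ) (h : ∀ i, ω i ∈ Set.Ico (0 : ℝ) 1)
    (h' : ∀ i, ω' i ∈ Set.Ico (0 : ℝ) 1)
    (e : ∀ k, ch ((2 * Real.pi) • ω) k = ch ((2 * Real.pi) • ω') k) : ω = ω' := by
  funext i
  have h1 : ch ((2 * Real.pi) • (ω - ω')) (Pi.single i 1) = 1 := by
    have h2 := ch_add_left ((2 * Real.pi) • (ω - ω')) ((2 * Real.pi) • ω') (Pi.single i 1)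
    rw [← smul_add, sub_add_cancel, e] at h2
    have h3 : ch ((2 * Real.pi) • ω') (Pi.single i 1) ≠ 0 := by
      rw [← norm_ne_zero_iff, ch_norm]; exact one_ne_zero
    exact (mul_eq_right₀ h3).1 h2.symm
  rw [ch_eq_one_iff] at h1
  obtain ⟨n, hn⟩ := h1
  rw [Finset.sum_eq_single i] at hn
  · simp only [Pi.single_eq_same, Int.cast_one, one_mul, Pi.sub_apply] at hn
    have a1 := h i
    have a2 := h' i
    have b1 : (n : ℝ) < 1 := by rw [← hn]; linarith [a1.2, a2.1]
    have b2 : (-1 : ℝ) < n := by rw [← hn]; linarith [a1.1, a2.2]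
    have b3 : n < 1 := by exact_mod_cast b1
    have b4 : -1 < n := by exact_mod_cast b2
    have : n = 0 := by omega
    rw [this] at hn
    push_cast at hn
    linarith
  · intro j _ hj; simp [Pi.single_eq_of_ne hj]
  · simp

/-- `ch` as an additive hom -/
noncomputable def chHom {d : ℕ} (ξ : Fin d → ℝ) : (Fin d → ℤ) →+ Additive ℂ where
  toFun k := Additive.ofMul (ch ξ k)
  map_zero' := by rw [ch_zero]; rfl
  map_add' k l := by rw [ch_add]; rfl

lemma pair_mulVec {d : ℕ} (N : Matrix (Fin d) (Fin d) ℤ) (ω : Fin d → ℝ) (j : Fin d → ℤ) :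
    ∑ i, ((N.mulVec j) i : ℝ) * ω i
      = ∑ i, (j i : ℝ) * ((N.map (Int.cast : ℤ → ℝ)).transpose.mulVec ω) i := by
  simp only [Matrix.mulVec, dotProduct, Int.cast_sum, Int.cast_mul, Finset.sum_mul,
    Finset.mul_sum, Matrix.transpose_apply, Matrix.map_apply]
  rw [Finset.sum_comm]
  refine Finset.sum_congr rfl fun i _ => Finset.sum_congr rfl fun k _ => by ring

lemma inLat_iff {d : ℕ} (N : Matrix (Fin d) (Fin d) ℤ) (ω : Fin d → ℝ) :
    inLat N ω ↔ ∀ j, ch ((2 * Real.pi) • ω) (N.mulVec j) = 1 := by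
  constructor
  · rintro ⟨k, hk⟩ j
    rw [ch_eq_one_iff, pair_mulVec, hk]
    exact ⟨∑ i, j i * k i, by push_cast; rfl⟩
  · intro h
    have : ∀ i, ∃ n : ℤ, ((N.map (Int.cast : ℤ → ℝ)).transpose.mulVec ω) i = n := by
      intro i
      have := h (Pi.single i 1)
      rw [ch_eq_one_iff, pair_mulVec] at this
      obtain ⟨n, hn⟩ := this
      refine ⟨n, hn ▸ ?_⟩
      rw [Finset.sum_eq_single i]
      · simp
      · intro j _ hj; simp [Pi.single_eq_of_ne hj]
      · simp
    choose k hk using this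
    exact ⟨k, funext hk⟩

abbrev QG {d : ℕ} (N : Matrix (Fin d) (Fin d) ℤ) : Type :=
  (Fin d → ℤ) ⧸ LinearMap.range N.mulVecLin

lemma mulVec_inj {d : ℕ} (N : Matrix (Fin d) (Fin d) ℤ) (hN : N.det ≠ 0) :
    Function.Injective N.mulVec := by
  intro x y h
  have : N.mulVec (x - y) = 0 := by rw [Matrix.mulVec_sub, h, sub_self]
  exact sub_eq_zero.1 (Matrix.eq_zero_of_mulVec_eq_zero hN this)

lemma card_QG {d : ℕ} (N : Matrix (Fin d) (Fin d) ℤ) (hN : N.det ≠ 0) :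
    Nat.card (QG N) = N.det.natAbs := by
  have hinj : Function.Injective N.mulVecLin := mulVec_inj N hN
  have := Submodule.natAbs_det_equiv (LinearMap.range N.mulVecLin)
    (LinearEquiv.ofInjective N.mulVecLin hinj)
  rw [← this, ← LinearMap.det_toLin' N]
  congr 2

noncomputable def toChar {d : ℕ} (N : Matrix (Fin d) (Fin d) ℤ) (ω : Omega N) :
    AddChar (QG N) ℂ :=
  AddChar.toAddMonoidHomEquiv.symm
    (QuotientAddGroup.lift (LinearMap.range N.mulVecLin).toAddSubgroup
      (chHom ((2 * Real.pi) • ω.1)) (by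
        rintro _ ⟨j, rfl⟩
        exact (inLat_iff N ω.1).1 ω.2.1 j))

lemma toChar_apply {d : ℕ} (N : Matrix (Fin d) (Fin d) ℤ) (ω : Omega N) (m : Fin d → ℤ) :
    toChar N ω (Submodule.Quotient.mk m) = ch ((2 * Real.pi) • ω.1) m := rfl

lemma toChar_bij {d : ℕ} (N : Matrix (Fin d) (Fin d) ℤ) (hN : N.det ≠ 0) :
    Function.Bijective (toChar N) := by
  have hfin : Finite (QG N) := Nat.finite_of_card_ne_zero (by
    rw [card_QG N hN]; simpa using hN)
  constructor
  · intro ω ω' h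
    apply Subtype.ext
    refine ch_inj _ _ ω.2.2 ω'.2.2 fun k => ?_
    rw [← toChar_apply, ← toChar_apply, h]
  · intro ψ
    let z : Fin d → ℂ := fun i => ψ (Submodule.Quotient.mk (Pi.single i 1))
    have hz : ∀ i, ‖z i‖ = 1 := fun i => AddChar.norm_apply ψ _
    let ω : Fin d → ℝ := fun i => Int.fract (-(Complex.arg (z i)) / (2 * Real.pi))
    have hω : ∀ i, ω i ∈ Set.Ico (0 : ℝ) 1 := fun i => ⟨Int.fract_nonneg _, Int.fract_lt_one _⟩
    have h1 : ∀ i, ch ((2 * Real.pi) • ω) (Pi.single i 1) = z i := by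
      intro i
      rw [ch_single]
      have e1 : -(Complex.I * ((((2 * Real.pi) • ω) i : ℝ) : ℂ))
          = (Complex.arg (z i) : ℂ) * Complex.I
            + (⌊(-(Complex.arg (z i)) / (2 * Real.pi))⌋ : ℤ) * (2 * Real.pi * Complex.I) := by
        simp only [Pi.smul_apply, smul_eq_mul, ω, Int.fract]
        have : (Real.pi : ℂ) ≠ 0 := by exact_mod_cast Real.pi_ne_zero
        push_cast
        field_simp
        ring
      rw [e1, Complex.exp_add, Complex.exp_int_mul_two_pi_mul_I, mul_one]
      have := Complex.norm_mul_exp_arg_mul_I (z i)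
      rwa [hz, Complex.ofReal_one, one_mul] at this
    have h2 : ∀ m, ch ((2 * Real.pi) • ω) m = ψ (Submodule.Quotient.mk m) := by
      have : chHom ((2 * Real.pi) • ω) = (AddChar.toAddMonoidHomEquiv ψ).comp
          (QuotientAddGroup.mk' (LinearMap.range N.mulVecLin).toAddSubgroup) := by
        apply AddMonoidHom.functions_ext'
        intro i
        apply AddMonoidHom.ext_int
        exact h1 i
      intro m
      exact DFunLike.congr_fun this m
    refine ⟨⟨ω, (inLat_iff N ω).2 fun j => ?_, hω⟩, ?_⟩
    · have h3 : (Submodule.Quotient.mk (N.mulVec j) : QG N) = 0 :=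
        (Submodule.Quotient.mk_eq_zero (LinearMap.range N.mulVecLin)).2
          (LinearMap.mem_range_self N.mulVecLin j)
      rw [h2, h3]
      exact AddChar.map_zero_eq_one ψ
    · ext x
      obtain ⟨m, rfl⟩ := Submodule.Quotient.mk_surjective _ x
      rw [toChar_apply]
      exact h2 m

lemma Omega_finite {d : ℕ} (N : Matrix (Fin d) (Fin d) ℤ) (hN : N.det ≠ 0) :
    (Omega N).Finite := by
  have hfin : Finite (QG N) := Nat.finite_of_card_ne_zero (by
    rw [card_QG N hN]; simpa using hN)
  exact Finite.of_injective _ (toChar_bij N hN).1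

lemma charsum {d : ℕ} (N : Matrix (Fin d) (Fin d) ℤ) (hN : N.det ≠ 0) (m : Fin d → ℤ) :
    ∑ ω ∈ (Omega_finite N hN).toFinset, ch ((2 * Real.pi) • ω) m
      = if m ∈ Set.range N.mulVec then ((|N.det| : ℤ) : ℂ) else 0 := by
  have hfin : Finite (QG N) := Nat.finite_of_card_ne_zero (by
    rw [card_QG N hN]; simpa using hN)
  have : Fintype (QG N) := Fintype.ofFinite _
  have : Fintype (Omega N) := (Omega_finite N hN).fintype
  have h := AddChar.sum_apply_eq_ite (Submodule.Quotient.mk m : QG N)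
  rw [← (Equiv.ofBijective _ (toChar_bij N hN)).sum_comp] at h
  simp only [Equiv.ofBijective_apply, toChar_apply] at h
  rw [← Nat.card_eq_fintype_card, card_QG N hN] at h
  have e1 : ∑ ω ∈ (Omega_finite N hN).toFinset, ch ((2 * Real.pi) • ω) m
      = ∑ ω : Omega N, ch ((2 * Real.pi) • ω.1) m := by
    apply Finset.sum_subtype
    simp
  have e2 : (m ∈ Set.range N.mulVec) ↔ (Submodule.Quotient.mk m : QG N) = 0 := by
    rw [Submodule.Quotient.mk_eq_zero]; rfl
  have e3 : ((|N.det| : ℤ) : ℂ) = ((N.det.natAbs : ℕ) : ℂ) := by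
    rw [Int.abs_eq_natAbs]; simp
  rw [e1, h, e3]
  simp only [e2]

noncomputable def CC {d : ℕ} (u : (Fin d → ℤ) → ℂ) (ω : Fin d → ℝ) (p : Fin d → ℤ) : ℂ :=
  ∑' m : Fin d → ℤ, ch ((2 * Real.pi) • ω) m * u m * starRingEnd ℂ (u (m - p))

noncomputable def KK {d : ℕ} (u : (Fin d → ℤ) → ℂ) (N : Matrix (Fin d) (Fin d) ℤ)
    (n k : Fin d → ℤ) : ℂ :=
  ((|N.det| : ℤ) : ℂ) * ∑' j : Fin d → ℤ, u (n - N.mulVec j) * starRingEnd ℂ (u (k - N.mulVec j))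

lemma l1_bdd {α : Type*} {u : α → ℂ} (hu : Summable fun k => ‖u k‖) (k : α) :
    ‖u k‖ ≤ ∑' k, ‖u k‖ :=
  hu.le_tsum k fun _ _ => norm_nonneg _

lemma CC_summable {d : ℕ} {u : (Fin d → ℤ) → ℂ} (hu : Summable fun k => ‖u k‖)
    (ω : Fin d → ℝ) (p : Fin d → ℤ) :
    Summable fun m => ch ((2 * Real.pi) • ω) m * u m * starRingEnd ℂ (u (m - p)) := by
  refine Summable.of_norm_bounded (hu.mul_right (∑' k, ‖u k‖)) fun m => ?_
  rw [norm_mul, norm_mul, ch_norm, one_mul, RCLike.norm_conj]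
  exact mul_le_mul_of_nonneg_left (l1_bdd hu _) (norm_nonneg _)

lemma KK_eq {d : ℕ} {u : (Fin d → ℤ) → ℂ} (hu : Summable fun k => ‖u k‖)
    (N : Matrix (Fin d) (Fin d) ℤ) (hN : N.det ≠ 0) (n k : Fin d → ℤ) :
    KK u N n k = ∑ ω ∈ (Omega_finite N hN).toFinset,
      ch ((2 * Real.pi) • ω) (-n) * CC u ω (n - k) := by
  let g : (Fin d → ℤ) → ℂ := fun m =>
    (if m ∈ Set.range N.mulVec then ((|N.det| : ℤ) : ℂ) else 0) *
      (u (n - m) * starRingEnd ℂ (u (k - m)))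
  have h1 : KK u N n k = ∑' m, g m := by
    rw [← (mulVec_inj N hN).tsum_eq (f := g)]
    · unfold KK
      rw [← tsum_mul_left]
      refine tsum_congr fun j => ?_
      simp [g]
    · intro m hm
      by_contra hc
      exact hm (by simp only [g]; rw [if_neg hc, zero_mul])
  rw [h1, ← (Equiv.subLeft n).tsum_eq g]
  have h2 : ∀ m, g (Equiv.subLeft n m) = ∑ ω ∈ (Omega_finite N hN).toFinset,
      ch ((2 * Real.pi) • ω) (-n) *
        (ch ((2 * Real.pi) • ω) m * u m * starRingEnd ℂ (u (m - (n - k)))) := by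
    intro m
    have e1 : (n - m ∈ Set.range N.mulVec) ↔ (m + -n ∈ Set.range N.mulVec) := by
      constructor
      · rintro ⟨j, hj⟩; exact ⟨-j, by rw [Matrix.mulVec_neg, hj]; abel⟩
      · rintro ⟨j, hj⟩; exact ⟨-j, by rw [Matrix.mulVec_neg, hj]; abel⟩
    simp only [g, Equiv.subLeft_apply]
    simp only [e1]
    rw [← charsum N hN, Finset.sum_mul]
    refine Finset.sum_congr rfl fun ω _ => ?_
    rw [ch_add, sub_sub_cancel, show k - (n - m) = m - (n - k) by abel]
    ring
  rw [tsum_congr h2, Summable.tsum_finsetSum]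
  · refine Finset.sum_congr rfl fun ω _ => ?_
    rw [tsum_mul_left, CC]
  · intro ω _
    exact (CC_summable hu ω _).mul_left _

lemma ST_eq {d : ℕ} {u : (Fin d → ℤ) → ℂ} (hu : Summable fun k => ‖u k‖)
    (N : Matrix (Fin d) (Fin d) ℤ) (hN : N.det ≠ 0) (v : (Fin d → ℤ) → ℂ)
    (hv : ∃ C, ∀ k, ‖v k‖ ≤ C) (n : Fin d → ℤ) :
    HasSum (fun k => v k * KK u N n k)
      (((|N.det| : ℤ) : ℂ)⁻¹ * subdivOp u N (transOp u N v) n) := by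
  obtain ⟨C, hC⟩ := hv
  have hC0 : 0 ≤ C := (norm_nonneg _).trans (hC 0)
  have hD : ((|N.det| : ℤ) : ℂ) ≠ 0 := by simpa using hN
  set D : ℂ := ((|N.det| : ℤ) : ℂ) with hDdef
  let F : (Fin d → ℤ) × (Fin d → ℤ) → ℂ := fun x =>
    D * (v x.2 * (u (n - N.mulVec x.1) * starRingEnd ℂ (u (x.2 - N.mulVec x.1))))
  have hinj : Function.Injective fun j => n - N.mulVec j := fun a b h =>
    mulVec_inj N hN (by simpa using h)
  have hF : Summable F := by
    have hp : Summable fun x : (Fin d → ℤ) × (Fin d → ℤ) =>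
        ‖u (n - N.mulVec x.1)‖ * ‖u x.2‖ := by
      have hu1 : Summable fun j => ‖u (n - N.mulVec j)‖ := hu.comp_injective hinj
      exact Summable.mul_of_nonneg (f := fun j => ‖u (n - N.mulVec j)‖) (g := fun j => ‖u j‖)
        hu1 hu (fun _ => norm_nonneg _) (fun _ => norm_nonneg _)
    let e : (Fin d → ℤ) × (Fin d → ℤ) ≃ (Fin d → ℤ) × (Fin d → ℤ) :=
      { toFun := fun x => (x.1, x.2 - N.mulVec x.1)
        invFun := fun x => (x.1, x.2 + N.mulVec x.1)
        left_inv := fun x => by simp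
        right_inv := fun x => by simp }
    have hp2 := (e.summable_iff (f := fun x : (Fin d → ℤ) × (Fin d → ℤ) =>
        ‖u (n - N.mulVec x.1)‖ * ‖u x.2‖)).2 hp
    refine Summable.mul_left _ (Summable.of_norm_bounded (hp2.mul_left C) fun x => ?_)
    rw [norm_mul, norm_mul, RCLike.norm_conj]
    exact mul_le_mul_of_nonneg_right (hC _) (by positivity)
  have hF' : Summable (fun x : (Fin d → ℤ) × (Fin d → ℤ) => F x.swap) := hF.prod_symm
  have h1 : ∑' x, F x = D⁻¹ * subdivOp u N (transOp u N v) n := by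
    rw [hF.tsum_prod]
    unfold subdivOp transOp
    rw [← hDdef, inv_mul_cancel_left₀ hD]
    refine tsum_congr fun j => ?_
    simp only [F]
    rw [tsum_mul_left, mul_assoc, ← tsum_mul_right]
    congr 1
    refine tsum_congr fun k => ?_
    ring
  have h2 : ∀ k, ∑' j, F (j, k) = v k * KK u N n k := by
    intro k
    simp only [F, KK]
    rw [tsum_mul_left, tsum_mul_left, ← hDdef]
    ring
  have h3 : HasSum (fun x : (Fin d → ℤ) × (Fin d → ℤ) => F x.swap) (∑' x, F x) := by
    have := hF.hasSum
    rw [← (Equiv.prodComm _ _).hasSum_iff] at this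
    exact this
  rw [← h1]
  have h4 := h3.prod_fiberwise (fun k => (hF'.prod_factor k).hasSum)
  simpa only [Prod.swap_prod_mk, h2] using h4

lemma fserd_eq {d : ℕ} (u : (Fin d → ℤ) → ℂ) (ξ : Fin d → ℝ) :
    fserd u ξ = ∑' k, u k * ch ξ k := rfl

lemma fserd_summable {d : ℕ} {u : (Fin d → ℤ) → ℂ} (hu : Summable fun k => ‖u k‖)
    (ξ : Fin d → ℝ) : Summable fun k => ‖u k * ch ξ k‖ := by
  simpa [ch_norm] using hu

lemma CC_fser {d : ℕ} {u : (Fin d → ℤ) → ℂ} (hu : Summable fun k => ‖u k‖)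
    (ω ξ : Fin d → ℝ) :
    (Summable fun p => ‖CC u ω p‖) ∧
    fserd (CC u ω) ξ = fserd u (ξ + (2 * Real.pi) • ω) * starRingEnd ℂ (fserd u ξ) := by
  have s1 := fserd_summable hu (ξ + (2 * Real.pi) • ω)
  have s2 : Summable fun k => ‖starRingEnd ℂ (u k * ch ξ k)‖ := by
    simpa only [RCLike.norm_conj] using fserd_summable hu ξ
  let F : (Fin d → ℤ) × (Fin d → ℤ) → ℂ := fun x =>
    (u x.1 * ch (ξ + (2 * Real.pi) • ω) x.1) * starRingEnd ℂ (u x.2 * ch ξ x.2)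
  have hF : Summable fun x => ‖F x‖ := by
    have := Summable.mul_of_nonneg s1 s2 (fun _ => norm_nonneg _) (fun _ => norm_nonneg _)
    simpa only [F, norm_mul] using this
  let e : (Fin d → ℤ) × (Fin d → ℤ) ≃ (Fin d → ℤ) × (Fin d → ℤ) :=
    { toFun := fun x => (x.2, x.2 - x.1)
      invFun := fun x => (x.1 - x.2, x.1)
      left_inv := fun x => by simp
      right_inv := fun x => by simp }
  have hFe : ∀ p m, F (e (p, m)) =
      ch ((2 * Real.pi) • ω) m * u m * starRingEnd ℂ (u (m - p)) * ch ξ p := by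
    intro p m
    simp only [F, e, Equiv.coe_fn_mk, map_mul, ch_add_left]
    rw [← ch_neg]
    have : ch ξ p = ch ξ m * ch ξ (-(m - p)) := by rw [← ch_add]; congr 1; abel
    rw [this]; ring
  have hE : Summable fun x => ‖F (e x)‖ := (e.summable_iff (f := fun x => ‖F x‖)).2 hF
  have hC : ∀ p, CC u ω p * ch ξ p = ∑' m, F (e (p, m)) := by
    intro p
    simp only [hFe]
    rw [tsum_mul_right, CC]
  constructor
  · refine Summable.of_nonneg_of_le (fun _ => norm_nonneg _) (fun p => ?_) hE.prod
    have : ‖CC u ω p‖ = ‖CC u ω p * ch ξ p‖ := by rw [norm_mul, ch_norm, mul_one]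
    rw [this, hC]
    exact norm_tsum_le_tsum_norm (hE.prod_factor p)
  · rw [fserd_eq, tsum_congr hC, ← Summable.tsum_prod (f := fun x => F (e x)) hE.of_norm,
      e.tsum_eq F, fserd_eq, fserd_eq, Complex.conj_tsum]
    exact (tsum_mul_tsum_of_summable_norm s1 s2).symm

lemma fserd_continuous {d : ℕ} {u : (Fin d → ℤ) → ℂ} (hu : Summable fun k => ‖u k‖) :
    Continuous (fserd u) := by
  unfold fserd
  refine continuous_tsum (fun k => by fun_prop) hu fun k ξ => ?_
  have := ch_norm ξ k
  unfold ch at this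
  rw [norm_mul, this, mul_one]

lemma orthonormal_zero {E : Type*} [NormedAddCommGroup E] [InnerProductSpace ℂ E] {α : Type*}
    {v : α → E} (hv : Orthonormal ℂ v) {c : α → ℂ} (h : HasSum (fun k => c k • v k) 0) :
    ∀ k, c k = 0 := by
  intro k
  have h1 := (innerSL ℂ (v k)).hasSum h
  have h2 : HasSum (fun j => (innerSL ℂ (v k)) (c j • v j)) (c k) := by
    have h3 : (innerSL ℂ (v k)) (c k • v k) = c k := by
      simp [inner_self_eq_norm_sq_to_K, hv.1 k]
    have h4 := hasSum_single (f := fun j => (innerSL ℂ (v k)) (c j • v j)) k (fun j hj => by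
      simp [hv.2 hj.symm])
    rwa [h3] at h4
  have := h1.unique h2
  simpa using this.symm

lemma toLp_aux {X α : Type*} [TopologicalSpace X] [CompactSpace X] [MeasurableSpace X]
    [BorelSpace X] (μ : Measure X) (_ : IsFiniteMeasure μ) (c : α → ℂ) (g : α → C(X, ℂ))
    (h : HasSum (fun k => c k • g k) 0) :
    HasSum (fun k => c k • ContinuousMap.toLp (E := ℂ) 2 μ ℂ (g k)) 0 := by
  have := (ContinuousMap.toLp (E := ℂ) 2 μ ℂ).hasSum h
  simpa only [map_smul, map_zero] using this

lemma fserd_inj {d : ℕ} {D : (Fin d → ℤ) → ℂ} (hD : Summable fun k => ‖D k‖)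
    (h : ∀ ξ, fserd D ξ = 0) : ∀ k, D k = 0 := by
  have hs : Summable fun k : Fin d → ℤ => D k • UnitAddTorus.mFourier (-k) := by
    apply Summable.of_norm
    simpa [norm_smul, UnitAddTorus.mFourier_norm] using hD
  have h0 : HasSum (fun k : Fin d → ℤ => D k • UnitAddTorus.mFourier (-k)) 0 := by
    convert! hs.hasSum
    symm
    ext x
    rw [← ContinuousMap.tsum_apply hs]
    obtain ⟨y, rfl⟩ : ∃ y : Fin d → ℝ, (fun i => (y i : UnitAddCircle)) = x := by
      choose y hy using fun i => QuotientAddGroup.mk_surjective (x i)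
      exact ⟨y, funext hy⟩
    have := h ((2 * Real.pi) • y)
    rw [fserd_eq] at this
    rw [ContinuousMap.zero_apply, ← this]
    refine tsum_congr fun k => ?_
    simp only [ContinuousMap.smul_apply, smul_eq_mul, UnitAddTorus.mFourier, ContinuousMap.coe_mk,
      fourier_coe_apply, ch, ← Complex.exp_sum]
    congr 2
    push_cast
    rw [Finset.mul_sum, ← Finset.sum_neg_distrib]
    refine Finset.sum_congr rfl fun i _ => ?_
    simp
    ring
  have ho := (UnitAddTorus.orthonormal_mFourier (d := Fin d)).comp _ (neg_injective)
  refine orthonormal_zero ho ?_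
  exact toLp_aux _ _ D _ h0

lemma ch_indep {d : ℕ} (L : Finset (Fin d → ℝ)) (hL : ∀ ω ∈ L, ∀ i, ω i ∈ Set.Ico (0 : ℝ) 1)
    (c : (Fin d → ℝ) → ℂ) (h : ∀ n, ∑ ω ∈ L, ch ((2 * Real.pi) • ω) n * c ω = 0) :
    ∀ ω ∈ L, c ω = 0 := by
  let f : L → (Multiplicative (Fin d → ℤ) →* ℂ) := fun ω =>
    { toFun := fun n => ch ((2 * Real.pi) • ω.1) n.toAdd
      map_one' := ch_zero _
      map_mul' := fun a b => ch_add _ _ _ }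
  have hf : Function.Injective f := fun a b hab => Subtype.ext
    (ch_inj _ _ (hL _ a.2) (hL _ b.2) fun k => DFunLike.congr_fun hab (Multiplicative.ofAdd k))
  have hi := (linearIndependent_monoidHom (Multiplicative (Fin d → ℤ)) ℂ).comp f hf
  rw [Fintype.linearIndependent_iff] at hi
  intro ω hω
  refine hi (fun ω => c ω.1) ?_ ⟨ω, hω⟩
  funext n
  rw [Pi.zero_apply, ← h n.toAdd, ← Finset.sum_coe_sort L, Finset.sum_apply]
  refine Finset.sum_congr rfl fun x _ => ?_
  simp only [Function.comp, Pi.smul_apply, smul_eq_mul]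
  exact mul_comm _ _

section generic

variable {d : ℕ} {ι : Type} [Fintype ι] (u : ι → (Fin d → ℤ) → ℂ)
  (N : ι → Matrix (Fin d) (Fin d) ℤ)

noncomputable def DD (ω : Fin d → ℝ) (p : Fin d → ℤ) : ℂ :=
  ∑ i, if inLat (N i) ω then CC (u i) ω p else 0

noncomputable def Lam (hN : ∀ i, (N i).det ≠ 0) : Finset (Fin d → ℝ) :=
  insert 0 (Finset.univ.biUnion fun i => (Omega_finite (N i) (hN i)).toFinset)

lemma inLat_zero (A : Matrix (Fin d) (Fin d) ℤ) : inLat A 0 :=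
  ⟨0, by funext i; simp⟩

lemma Lam_Ico (hN : ∀ i, (N i).det ≠ 0) : ∀ ω ∈ Lam N hN, ∀ i, ω i ∈ Set.Ico (0 : ℝ) 1 := by
  intro ω hω
  simp only [Lam, Finset.mem_insert, Finset.mem_biUnion, Finset.mem_univ, true_and,
    Set.Finite.mem_toFinset] at hω
  rcases hω with rfl | ⟨i, hi⟩
  · intro i; simp
  · exact hi.2

lemma Omega_eq_filter (hN : ∀ i, (N i).det ≠ 0) (i : ι) :
    (Omega_finite (N i) (hN i)).toFinset = (Lam N hN).filter (fun ω => inLat (N i) ω) := by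
  ext ω
  rw [Finset.mem_filter, Set.Finite.mem_toFinset]
  constructor
  · intro h
    refine ⟨?_, h.1⟩
    simp only [Lam, Finset.mem_insert, Finset.mem_biUnion, Finset.mem_univ, true_and,
      Set.Finite.mem_toFinset]
    exact Or.inr ⟨i, h⟩
  · rintro ⟨h, h'⟩
    exact ⟨h', Lam_Ico N hN ω h⟩

lemma Ktot_eq (hu : ∀ i, Summable fun k => ‖u i k‖) (hN : ∀ i, (N i).det ≠ 0)
    (n k : Fin d → ℤ) :
    ∑ i, KK (u i) (N i) n k
      = ∑ ω ∈ Lam N hN, ch ((2 * Real.pi) • ω) (-n) * DD u N ω (n - k) := by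
  simp only [DD, Finset.mul_sum]
  rw [Finset.sum_comm]
  refine Finset.sum_congr rfl fun i _ => ?_
  rw [KK_eq (hu i) (N i) (hN i), Omega_eq_filter N hN i, Finset.sum_filter]
  refine Finset.sum_congr rfl fun ω _ => ?_
  split_ifs <;> simp

lemma PR_iff_kernel (hu : ∀ i, Summable fun k => ‖u i k‖) (hN : ∀ i, (N i).det ≠ 0) :
    (∀ v : (Fin d → ℤ) → ℂ, (∃ C, ∀ k, ‖v k‖ ≤ C) → ∀ n : Fin d → ℤ,
      v n = ∑ i, ((|(N i).det| : ℤ) : ℂ)⁻¹ * subdivOp (u i) (N i) (transOp (u i) (N i) v) n)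
    ↔ ∀ n k, ∑ i, KK (u i) (N i) n k = if n = k then 1 else 0 := by
  have key : ∀ v : (Fin d → ℤ) → ℂ, (∃ C, ∀ k, ‖v k‖ ≤ C) → ∀ n : Fin d → ℤ,
      HasSum (fun k => v k * ∑ i, KK (u i) (N i) n k)
       (∑ i, ((|(N i).det| : ℤ) : ℂ)⁻¹ * subdivOp (u i) (N i) (transOp (u i) (N i) v) n) := by
    intro v hv n
    simp only [Finset.mul_sum]
    exact hasSum_sum fun i _ => ST_eq (hu i) (N i) (hN i) v hv n
  constructor
  · intro h n k
    have hv : ∃ C, ∀ j, ‖(Pi.single k 1 : (Fin d → ℤ) → ℂ) j‖ ≤ C := by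
      refine ⟨1, fun j => ?_⟩
      rw [Pi.single_apply]
      split_ifs <;> simp
    have h1 := key _ hv n
    rw [← h _ hv n] at h1
    have h2 := hasSum_single (f := fun j => (Pi.single k 1 : (Fin d → ℤ) → ℂ) j *
      ∑ i, KK (u i) (N i) n j) k (fun j hj => by rw [Pi.single_eq_of_ne hj, zero_mul])
    have h3 := h2.unique h1
    rw [Pi.single_eq_same, one_mul, Pi.single_apply] at h3
    exact h3
  · intro h v hv n
    have h1 := key v hv n
    have h2 := hasSum_single (f := fun j => v j * ∑ i, KK (u i) (N i) n j) n (fun j hj => by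
      rw [h, if_neg hj.symm, mul_zero])
    have h3 := h2.unique h1
    rwa [h, if_pos rfl, mul_one] at h3

lemma kernel_iff (hu : ∀ i, Summable fun k => ‖u i k‖) (hN : ∀ i, (N i).det ≠ 0) :
    (∀ n k, ∑ i, KK (u i) (N i) n k = if n = k then (1 : ℂ) else 0) ↔
    ∀ ω ∈ Lam N hN, ∀ p, DD u N ω p = if ω = 0 then (if p = 0 then 1 else 0) else 0 := by
  have h0 : (0 : Fin d → ℝ) ∈ Lam N hN := Finset.mem_insert_self _ _
  have hδ : ∀ n p : Fin d → ℤ, ∑ ω ∈ Lam N hN, ch ((2 * Real.pi) • ω) n *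
      (if ω = 0 then (if p = 0 then (1 : ℂ) else 0) else 0) = if p = 0 then 1 else 0 := by
    intro n p
    rw [Finset.sum_eq_single_of_mem 0 h0]
    · simp [ch_zero_left]
    · intro ω _ hω; simp [hω]
  constructor
  · intro h ω hω p
    refine sub_eq_zero.1 (ch_indep (Lam N hN) (Lam_Ico N hN)
      (fun ω => DD u N ω p - if ω = 0 then (if p = 0 then 1 else 0) else 0) (fun n => ?_) ω hω)
    simp only [mul_sub, Finset.sum_sub_distrib]
    rw [hδ]
    have h1 := Ktot_eq u N hu hN (-n) (-n - p)
    rw [h, neg_neg, sub_sub_cancel] at h1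
    rw [← h1, sub_eq_zero]
    have h2 : (-n = -n - p) ↔ p = 0 := by rw [eq_comm, sub_eq_self]
    simp only [h2]
  · intro h n k
    rw [Ktot_eq u N hu hN]
    rw [Finset.sum_congr rfl fun ω hω => by rw [h ω hω], hδ]
    simp [sub_eq_zero]

lemma DD_summable (hu : ∀ i, Summable fun k => ‖u i k‖) (ω : Fin d → ℝ) :
    Summable fun p => ‖DD u N ω p‖ := by
  refine Summable.of_nonneg_of_le (fun _ => norm_nonneg _) (fun p => norm_sum_le _ _) ?_
  refine summable_sum fun i _ => ?_
  split_ifs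
  · exact (CC_fser (hu i) ω 0).1
  · simp

lemma DD_fser (hu : ∀ i, Summable fun k => ‖u i k‖) (ω ξ : Fin d → ℝ) :
    fserd (DD u N ω) ξ = ∑ i, (if inLat (N i) ω then (1 : ℂ) else 0) *
      (fserd (u i) (ξ + (2 * Real.pi) • ω) * starRingEnd ℂ (fserd (u i) ξ)) := by
  rw [fserd_eq]
  simp only [DD, Finset.sum_mul]
  rw [Summable.tsum_finsetSum]
  · refine Finset.sum_congr rfl fun i _ => ?_
    split_ifs
    · rw [one_mul, ← (CC_fser (hu i) ω ξ).2, fserd_eq]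
    · simp
  · intro i _
    split_ifs
    · exact (fserd_summable (CC_fser (hu i) ω 0).1 ξ).of_norm
    · simp

lemma fser_delta_iff {D : (Fin d → ℤ) → ℂ} (hD : Summable fun k => ‖D k‖) (c : ℂ) :
    (∀ p, D p = if p = 0 then c else 0) ↔ ∀ ξ, fserd D ξ = c := by
  have hd : ∀ ξ : Fin d → ℝ, HasSum (fun p : Fin d → ℤ => (if p = 0 then c else 0) * ch ξ p) c := by
    intro ξ
    have := hasSum_single (f := fun p : Fin d → ℤ => (if p = 0 then c else 0) * ch ξ p) 0
      (fun p hp => by simp [hp])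
    simpa [ch_zero] using this
  constructor
  · intro h ξ
    rw [fserd_eq, tsum_congr fun p => by rw [h p]]
    exact (hd ξ).tsum_eq
  · intro h
    have hs : Summable fun p : Fin d → ℤ => ‖if p = 0 then c else 0‖ := by
      have := (hd 0).summable.norm
      simpa only [norm_mul, ch_norm, mul_one] using this
    have h2 := fserd_inj (D := fun p => D p - if p = 0 then c else 0)
      (Summable.of_nonneg_of_le (fun _ => norm_nonneg _) (fun _ => norm_sub_le _ _) (hD.add hs))
      (fun ξ => by
        rw [fserd_eq]
        simp only [sub_mul]
        rw [Summable.tsum_sub (fserd_summable hD ξ).of_norm (hd ξ).summable, (hd ξ).tsum_eq,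
          ← fserd_eq, h, sub_self])
    exact fun p => sub_eq_zero.1 (h2 p)

lemma main_generic (hu : ∀ i, Summable fun k => ‖u i k‖) (hN : ∀ i, (N i).det ≠ 0) :
    (∀ v : (Fin d → ℤ) → ℂ, (∃ C, ∀ k, ‖v k‖ ≤ C) → ∀ n : Fin d → ℤ,
      v n = ∑ i, ((|(N i).det| : ℤ) : ℂ)⁻¹ * subdivOp (u i) (N i) (transOp (u i) (N i) v) n)
    ↔ ((∀ᵐ ξ : Fin d → ℝ ∂volume, ∑ i, ‖fserd (u i) ξ‖ ^ 2 = 1) ∧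
      ∀ ω ∈ (⋃ i, Omega (N i)) \ {0}, ∀ᵐ ξ : Fin d → ℝ ∂volume,
        ∑ i, (if inLat (N i) ω then (1 : ℂ) else 0) * fserd (u i) ξ *
              starRingEnd ℂ (fserd (u i) (ξ + (2 * Real.pi) • ω)) = 0) := by
  rw [PR_iff_kernel u N hu hN, kernel_iff u N hu hN]
  have hc : ∀ i, Continuous (fserd (u i)) := fun i => fserd_continuous (hu i)
  have A : (∀ᵐ ξ : Fin d → ℝ ∂volume, ∑ i, ‖fserd (u i) ξ‖ ^ 2 = 1) ↔
      ∀ p, DD u N 0 p = if p = 0 then 1 else 0 := by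
    rw [fser_delta_iff (DD_summable u N hu 0)]
    have c1 : Continuous fun ξ => ∑ i, ‖fserd (u i) ξ‖ ^ 2 :=
      continuous_finsetSum _ fun i _ => ((hc i).norm.pow 2)
    have := c1.ae_eq_iff_eq (μ := (volume : Measure (Fin d → ℝ))) (g := fun _ => (1 : ℝ))
      continuous_const
    refine (this.trans funext_iff).trans (forall_congr' fun ξ => ?_)
    rw [DD_fser u N hu]
    simp only [inLat_zero, if_true, smul_zero, add_zero, one_mul, Complex.mul_conj,
      Complex.normSq_eq_norm_sq]
    norm_cast
  have B : ∀ ω, (∀ᵐ ξ : Fin d → ℝ ∂volume,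
        ∑ i, (if inLat (N i) ω then (1 : ℂ) else 0) * fserd (u i) ξ *
              starRingEnd ℂ (fserd (u i) (ξ + (2 * Real.pi) • ω)) = 0) ↔
      ∀ p, DD u N ω p = 0 := by
    intro ω
    have e : (∀ p, DD u N ω p = 0) ↔ ∀ p, DD u N ω p = if p = 0 then 0 else 0 := by simp
    rw [e, fser_delta_iff (DD_summable u N hu ω)]
    have c1 : Continuous fun ξ => ∑ i, (if inLat (N i) ω then (1 : ℂ) else 0) * fserd (u i) ξ *
              starRingEnd ℂ (fserd (u i) (ξ + (2 * Real.pi) • ω)) := by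
      refine continuous_finsetSum _ fun i _ => ?_
      exact (continuous_const.mul (hc i)).mul
        (Complex.continuous_conj.comp ((hc i).comp (continuous_add_const _)))
    have := c1.ae_eq_iff_eq (μ := (volume : Measure (Fin d → ℝ))) (g := fun _ => (0 : ℂ))
      continuous_const
    refine (this.trans funext_iff).trans (forall_congr' fun ξ => ?_)
    rw [DD_fser u N hu, ← map_eq_zero (starRingEnd ℂ), map_sum]
    refine Eq.congr (Finset.sum_congr rfl fun i _ => ?_) rfl
    split_ifs <;> simp [mul_comm]
  rw [A]
  constructor
  · intro h
    refine ⟨fun p => by simpa using h 0 (Finset.mem_insert_self _ _) p, fun ω hω => ?_⟩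
    rw [B]
    intro p
    obtain ⟨h1, h2⟩ := hω
    have h3 : ω ≠ 0 := h2
    have h4 : ω ∈ Lam N hN := by
      simp only [Lam, Finset.mem_insert, Finset.mem_biUnion, Finset.mem_univ, true_and,
        Set.Finite.mem_toFinset]
      exact Or.inr (Set.mem_iUnion.1 h1)
    rw [h ω h4 p, if_neg h3]
  · rintro ⟨h1, h2⟩ ω hω p
    split_ifs with h3 h4
    · rw [h3, h1, if_pos h4]
    · rw [h3, h1, if_neg h4]
    · refine (B ω).1 (h2 ω ⟨?_, h3⟩) p
      simp only [Lam, Finset.mem_insert, Finset.mem_biUnion, Finset.mem_univ, true_and,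
        Set.Finite.mem_toFinset] at hω
      exact Set.mem_iUnion.2 (hω.resolve_left h3)

end generic

theorem perfect_reconstruction_iff_tight_framelet_filter_bank
    {d s : ℕ} (a : (Fin d → ℤ) → ℂ) (b : Fin s → (Fin d → ℤ) → ℂ)
    (ha : Summable fun k => ‖a k‖) (hb : ∀ ℓ, Summable fun k => ‖b ℓ k‖)
    (M : Matrix (Fin d) (Fin d) ℤ) (Ml : Fin s → Matrix (Fin d) (Fin d) ℤ)
    (hM : M.det ≠ 0) (hMl : ∀ ℓ, (Ml ℓ).det ≠ 0) :
    (∀ v : (Fin d → ℤ) → ℂ, (∃ C, ∀ k, ‖v k‖ ≤ C) →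
      ∀ n : Fin d → ℤ,
        v n = ((|M.det| : ℤ) : ℂ)⁻¹ * subdivOp a M (transOp a M v) n +
          ∑ ℓ : Fin s, ((|(Ml ℓ).det| : ℤ) : ℂ)⁻¹ *
            subdivOp (b ℓ) (Ml ℓ) (transOp (b ℓ) (Ml ℓ) v) n)
    ↔
    ((∀ᵐ ξ : Fin d → ℝ ∂volume,
        ‖fserd a ξ‖ ^ 2 + ∑ ℓ : Fin s, ‖fserd (b ℓ) ξ‖ ^ 2 = 1) ∧
      ∀ ω ∈ (Omega M ∪ ⋃ ℓ : Fin s, Omega (Ml ℓ)) \ {0},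
        ∀ᵐ ξ : Fin d → ℝ ∂volume,
          (if inLat M ω then (1 : ℂ) else 0) * fserd a ξ *
              starRingEnd ℂ (fserd a (ξ + (2 * Real.pi) • ω)) +
            ∑ ℓ : Fin s, (if inLat (Ml ℓ) ω then (1 : ℂ) else 0) * fserd (b ℓ) ξ *
              starRingEnd ℂ (fserd (b ℓ) (ξ + (2 * Real.pi) • ω)) = 0) := by
  have h := main_generic (ι := Option (Fin s)) (fun i => i.elim a b) (fun i => i.elim M Ml)
    (by rintro (_ | ℓ); exacts [ha, hb ℓ]) (by rintro (_ | ℓ); exacts [hM, hMl ℓ])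
  have hU : (⋃ i : Option (Fin s), Omega (i.elim M Ml)) = Omega M ∪ ⋃ ℓ : Fin s, Omega (Ml ℓ) :=
    iSup_option _
  simp only [Fintype.sum_option, Option.elim_none, Option.elim_some, hU] at h
  exact h
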